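/- arXiv:1305.2592 — 4 statements merged into one kernel-verified Lean document; each statement's English description precedes it below -/
import Mathlib

section
/- Fix an integer M ≥ 3 and define, for s ≥ 0, Δ(s, M) = log₂(1+s) − ∫₀¹ log₂(1 + (M s/2) u²) · 2(M−1)(M−2) u³ (1−u²)^{M−3} du. Then the function s ↦ Δ(s, M) is monotonically increasing on [0, ∞): for all 0 ≤ s₁ < s₂, Δ(s₁, M) ≤ Δ(s₂, M). -/
open Real

lemma aux_int_one (n : ℕ) :
    ∫ u in (0:ℝ)..1, (2 * ((n:ℝ) + 2) * ((n:ℝ) + 1) * u ^ 3 * (1 - u ^ 2) ^ n) = 1 := by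
  have h : ∀ u ∈ Set.uIcc (0:ℝ) 1, HasDerivAt
      (fun u : ℝ => -((1 - u ^ 2) ^ (n + 1) * (1 + ((n:ℝ) + 1) * u ^ 2)))
      (2 * ((n:ℝ) + 2) * ((n:ℝ) + 1) * u ^ 3 * (1 - u ^ 2) ^ n) u := by
    intro u _
    have h1 : HasDerivAt (fun u : ℝ => u ^ 2) (2 * u) u := by
      simpa using hasDerivAt_pow 2 u
    have h2 := (h1.const_sub 1).pow (n + 1)
    have h3 := (h1.const_mul ((n:ℝ) + 1)).const_add 1
    refine ((h2.mul h3).neg).congr_deriv ?_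
    simp only [Pi.pow_apply, Nat.add_sub_cancel]
    push_cast
    ring
  rw [intervalIntegral.integral_eq_sub_of_hasDerivAt h
    (Continuous.intervalIntegrable (by fun_prop) _ _)]
  simp

lemma aux_int_zero (n : ℕ) :
    ∫ u in (0:ℝ)..1, ((((n:ℝ) + 3) / 2 * u ^ 2 - 1) *
      (2 * ((n:ℝ) + 2) * ((n:ℝ) + 1) * u ^ 3 * (1 - u ^ 2) ^ n)) = 0 := by
  have h : ∀ u ∈ Set.uIcc (0:ℝ) 1, HasDerivAt
      (fun u : ℝ => -(((n:ℝ) + 2) * ((n:ℝ) + 1) / 2) * ((1 - u ^ 2) ^ (n + 1) * u ^ 4))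
      ((((n:ℝ) + 3) / 2 * u ^ 2 - 1) *
      (2 * ((n:ℝ) + 2) * ((n:ℝ) + 1) * u ^ 3 * (1 - u ^ 2) ^ n)) u := by
    intro u _
    have h1 : HasDerivAt (fun u : ℝ => u ^ 2) (2 * u) u := by
      simpa using hasDerivAt_pow 2 u
    have h2 := (h1.const_sub 1).pow (n + 1)
    have h3 : HasDerivAt (fun u : ℝ => u ^ 4) (4 * u ^ 3) u := by
      simpa using hasDerivAt_pow 4 u
    refine ((h2.mul h3).const_mul _).congr_deriv ?_
    simp only [Pi.pow_apply, Nat.add_sub_cancel]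
    push_cast
    ring
  rw [intervalIntegral.integral_eq_sub_of_hasDerivAt h
    (Continuous.intervalIntegrable (by fun_prop) _ _)]
  simp

lemma aux_log (a b x : ℝ) (ha : 0 ≤ a) (hab : a < b) (hx : 0 ≤ x) :
    Real.log (1 + b * x) - Real.log (1 + a * x) ≤
      Real.log (1 + b) - Real.log (1 + a) + (b - a) / ((1 + a) * (1 + b)) * (x - 1) := by
  have hb : 0 < b := lt_of_le_of_lt ha hab
  have p1 : 0 < 1 + b * x := by positivity
  have p2 : 0 < 1 + a * x := by positivity
  have p3 : 0 < 1 + b := by positivity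
  have p4 : 0 < 1 + a := by positivity
  have h := Real.log_le_sub_one_of_pos
    (show 0 < ((1 + b * x) * (1 + a)) / ((1 + a * x) * (1 + b)) by positivity)
  rw [Real.log_div (by positivity) (by positivity), Real.log_mul p1.ne' p4.ne',
    Real.log_mul p2.ne' p3.ne'] at h
  have h2 : (b - a) / ((1 + a) * (1 + b)) * (x - 1) -
      (((1 + b * x) * (1 + a)) / ((1 + a * x) * (1 + b)) - 1) =
      (b - a) * a * (x - 1) ^ 2 / ((1 + a) * (1 + b) * (1 + a * x)) := by
    field_simp
    ring
  have h3 : 0 ≤ (b - a) * a * (x - 1) ^ 2 / ((1 + a) * (1 + b) * (1 + a * x)) := by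
    have : 0 ≤ b - a := by linarith
    positivity
  linarith

lemma aux_integrable (n : ℕ) (s : ℝ) (hs : 0 ≤ s) :
    IntervalIntegrable (fun u : ℝ => Real.logb 2 (1 + (((n:ℝ) + 3) * s / 2) * u ^ 2) *
        (2 * ((n:ℝ) + 2) * ((n:ℝ) + 1) * u ^ 3 * (1 - u ^ 2) ^ n))
      MeasureTheory.volume 0 1 := by
  apply Continuous.intervalIntegrable
  have : Continuous fun u : ℝ => Real.log (1 + (((n:ℝ) + 3) * s / 2) * u ^ 2) := by
    apply Continuous.log (by fun_prop)
    intro u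
    positivity
  unfold Real.logb
  fun_prop

/-- Fix an integer `M ≥ 3` and define, for `s ≥ 0`,
`Δ(s, M) = log₂(1+s) − ∫₀¹ log₂(1 + (M s/2) u²) · 2(M−1)(M−2) u³ (1−u²)^{M−3} du`.
Then `s ↦ Δ(s, M)` is monotonically increasing on `[0, ∞)`:
for all `0 ≤ s₁ < s₂`, `Δ(s₁, M) ≤ Δ(s₂, M)`. -/
theorem gap_monotone (M : ℕ) (hM : 3 ≤ M)
    (Δ : ℝ → ℝ)
    (hΔ : ∀ s : ℝ, 0 ≤ s → Δ s = Real.logb 2 (1 + s) -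
      ∫ u in (0:ℝ)..1, Real.logb 2 (1 + (M * s / 2) * u ^ 2) *
        (2 * ((M:ℝ) - 1) * ((M:ℝ) - 2) * u ^ 3 * (1 - u ^ 2) ^ (M - 3)))
    (s₁ s₂ : ℝ) (hs₁ : 0 ≤ s₁) (hs : s₁ < s₂) :
    Δ s₁ ≤ Δ s₂ := by
  obtain ⟨n, rfl⟩ : ∃ n, M = n + 3 := ⟨M - 3, by omega⟩
  have hs₂ : 0 ≤ s₂ := hs₁.trans hs.le
  have e1 : (((n + 3 : ℕ) : ℝ)) = (n:ℝ) + 3 := by push_cast; ring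
  have e2 : (n:ℝ) + 3 - 1 = n + 2 := by ring
  have e3 : (n:ℝ) + 3 - 2 = n + 1 := by ring
  rw [hΔ s₁ hs₁, hΔ s₂ hs₂]
  simp only [e1, e2, e3, Nat.add_sub_cancel]
  have hl : 0 < Real.log 2 := Real.log_pos (by norm_num)
  set w : ℝ → ℝ := fun u => 2 * ((n:ℝ) + 2) * ((n:ℝ) + 1) * u ^ 3 * (1 - u ^ 2) ^ n with hw
  set C : ℝ := Real.logb 2 (1 + s₂) - Real.logb 2 (1 + s₁) with hC
  set D : ℝ := (s₂ - s₁) / ((1 + s₁) * (1 + s₂)) / Real.log 2 with hD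
  have i1 := aux_integrable n s₁ hs₁
  have i2 := aux_integrable n s₂ hs₂
  have j1 : IntervalIntegrable (fun u => C * w u) MeasureTheory.volume 0 1 :=
    Continuous.intervalIntegrable (by fun_prop) _ _
  have j2 : IntervalIntegrable (fun u => D * ((((n:ℝ) + 3) / 2 * u ^ 2 - 1) * w u))
      MeasureTheory.volume 0 1 :=
    Continuous.intervalIntegrable (by fun_prop) _ _
  have key := intervalIntegral.integral_mono_on (zero_le_one) (i2.sub i1) (j1.add j2) (by
    intro u hu
    have hu0 : 0 ≤ u := hu.1
    have hu1 : 0 ≤ 1 - u ^ 2 := by nlinarith [hu.1, hu.2]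
    have hwu : 0 ≤ w u := by simp only [hw]; positivity
    have hlog := aux_log s₁ s₂ (((n:ℝ) + 3) / 2 * u ^ 2) hs₁ hs (by positivity)
    have hdiv := div_le_div_of_nonneg_right hlog hl.le
    have := mul_le_mul_of_nonneg_right hdiv hwu
    have r2 : 1 + ((n:ℝ) + 3) * s₂ / 2 * u ^ 2 = 1 + s₂ * (((n:ℝ) + 3) / 2 * u ^ 2) := by ring
    have r1 : 1 + ((n:ℝ) + 3) * s₁ / 2 * u ^ 2 = 1 + s₁ * (((n:ℝ) + 3) / 2 * u ^ 2) := by ring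
    simp only [r1, r2, hC, hD, Real.logb]
    simp only [hw] at this ⊢
    refine le_trans (le_of_eq ?_) (this.trans (le_of_eq ?_)) <;> ring)
  rw [intervalIntegral.integral_sub i2 i1, intervalIntegral.integral_add j1 j2,
    intervalIntegral.integral_const_mul, intervalIntegral.integral_const_mul,
    aux_int_one, aux_int_zero] at key
  simp only [hC, hw] at key ⊢
  linarith
end

section
/- For every integer M ≥ 3, define Δ(s, M) = log₂(1+s) − ∫₀¹ log₂(1 + (M s/2) u²) · 2(M−1)(M−2) u³ (1−u²)^{M−3} du for s ≥ 0. Then as s → ∞, Δ(s, M) converges to Δ_M := 2(M−1)(M−2) ∫₀¹ log₂( 2/(M u²) ) · u³ (1−u²)^{M−3} du. -/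
open Filter Topology

lemma gap_weight_integral (k : ℕ) :
    ∫ u in (0:ℝ)..1, (2 * ((k:ℝ) + 2) * ((k:ℝ) + 1) * u ^ 3 * (1 - u ^ 2) ^ k) = 1 := by
  have h : ∀ u ∈ Set.uIcc (0:ℝ) 1, HasDerivAt
      (fun u : ℝ => -((1 - u ^ 2) ^ (k + 1) * (1 + ((k:ℝ) + 1) * u ^ 2)))
      (2 * ((k:ℝ) + 2) * ((k:ℝ) + 1) * u ^ 3 * (1 - u ^ 2) ^ k) u := by
    intro u _
    have h1 : HasDerivAt (fun u : ℝ => u ^ 2) (2 * u) u := by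
      simpa using hasDerivAt_pow 2 u
    have h2 := (h1.const_sub 1).pow (k + 1)
    have h3 := (h1.const_mul ((k:ℝ) + 1)).const_add 1
    refine (h2.mul h3).neg.congr_deriv ?_
    simp only [Pi.pow_apply, Nat.add_sub_cancel]
    push_cast
    ring
  rw [intervalIntegral.integral_eq_sub_of_hasDerivAt h]
  · simp
  · exact Continuous.intervalIntegrable (by fun_prop) _ _

lemma gap_ratio_bound (a s u : ℝ) (ha : 1 ≤ a) (hs : 0 ≤ s) (hu : 0 < u) (hu1 : u ≤ 1) :
    |Real.log (1 + s) - Real.log (1 + a * s * u ^ 2)| ≤ a + 2 / u := by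
  have hu2 : u ^ 2 ≤ 1 := by nlinarith
  have hu2p : 0 < u ^ 2 := by positivity
  have hp : 0 < 1 + a * s * u ^ 2 := by positivity
  have h1 : Real.log (1 + a * s * u ^ 2) ≤ Real.log a + Real.log (1 + s) := by
    rw [← Real.log_mul (by positivity) (by positivity)]
    apply Real.log_le_log hp
    nlinarith [mul_le_mul_of_nonneg_left hu2 (by positivity : 0 ≤ a * s)]
  have h2 : 2 * Real.log u + Real.log (1 + s) ≤ Real.log (1 + a * s * u ^ 2) := by
    have : 2 * Real.log u = Real.log (u ^ 2) := by simp
    rw [this, ← Real.log_mul (by positivity) (by positivity)]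
    apply Real.log_le_log (by positivity)
    nlinarith [mul_nonneg (mul_nonneg (sub_nonneg.2 ha) hs) hu2p.le]
  have h3 : Real.log a ≤ a - 1 := Real.log_le_sub_one_of_pos (by positivity)
  have h4 : -Real.log u ≤ u⁻¹ - 1 := by
    rw [← Real.log_inv]; exact Real.log_le_sub_one_of_pos (by positivity)
  have h5 : 0 < u⁻¹ := by positivity
  rw [div_eq_mul_inv, abs_le]
  constructor <;> linarith

lemma gap_pointwise (a u : ℝ) (ha : 1 ≤ a) (hu : 0 < u) :
    Tendsto (fun s : ℝ => Real.log (1 + s) - Real.log (1 + a * s * u ^ 2)) atTop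
      (𝓝 (Real.log (1 / (a * u ^ 2)))) := by
  have hi : Tendsto (fun s : ℝ => s⁻¹) atTop (𝓝 0) := tendsto_inv_atTop_zero
  have hc : 0 < a * u ^ 2 := by positivity
  have h : Tendsto (fun s : ℝ => (s⁻¹ + 1) / (s⁻¹ + a * u ^ 2)) atTop
      (𝓝 ((0 + 1) / (0 + a * u ^ 2))) :=
    (hi.add_const 1).div (hi.add_const _) (by simpa using hc.ne')
  rw [zero_add, zero_add] at h
  refine ((Real.continuousAt_log (by positivity)).tendsto.comp h).congr' ?_
  filter_upwards [eventually_gt_atTop 0] with s hs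
  rw [← Real.log_div (by positivity) (by positivity)]
  simp only [Function.comp]
  congr 1
  field_simp


/-- For every integer `M ≥ 3`, with
`Δ(s, M) = log₂(1+s) − ∫₀¹ log₂(1 + (M s/2) u²) · 2(M−1)(M−2) u³ (1−u²)^{M−3} du`,
as `s → ∞`, `Δ(s, M)` converges to
`Δ_M := 2(M−1)(M−2) ∫₀¹ log₂( 2/(M u²) ) · u³ (1−u²)^{M−3} du`. -/
theorem gap_tendsto_high_snr (M : ℕ) (hM : 3 ≤ M)
    (Δ : ℝ → ℝ)
    (hΔ : ∀ s : ℝ, 0 ≤ s → Δ s = Real.logb 2 (1 + s) -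
      ∫ u in (0:ℝ)..1, Real.logb 2 (1 + (M * s / 2) * u ^ 2) *
        (2 * ((M:ℝ) - 1) * ((M:ℝ) - 2) * u ^ 3 * (1 - u ^ 2) ^ (M - 3))) :
    Tendsto Δ atTop
      (𝓝 (2 * ((M:ℝ) - 1) * ((M:ℝ) - 2) *
        ∫ u in (0:ℝ)..1, Real.logb 2 (2 / (M * u ^ 2)) * u ^ 3 * (1 - u ^ 2) ^ (M - 3))) := by

  obtain ⟨k, rfl⟩ : ∃ k, M = k + 3 := ⟨M - 3, by omega⟩
  set a : ℝ := ((k + 3 : ℕ) : ℝ) / 2 with ha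
  have ha1 : 1 ≤ a := by rw [ha]; push_cast; have : (0:ℝ) ≤ k := k.cast_nonneg; linarith
  have hk : k + 3 - 3 = k := by omega
  have e1 : (((k + 3 : ℕ) : ℝ) - 1) = k + 2 := by push_cast; ring
  have e2 : (((k + 3 : ℕ) : ℝ) - 2) = k + 1 := by push_cast; ring
  simp only [hk, e1, e2] at hΔ ⊢
  have hl2 : 0 < Real.log 2 := Real.log_pos (by norm_num)
  let w : ℝ → ℝ := fun u => 2 * ((k:ℝ) + 2) * ((k:ℝ) + 1) * u ^ 3 * (1 - u ^ 2) ^ k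
  have hw : Continuous w := by fun_prop
  have hcont : ∀ s : ℝ, 0 ≤ s → Continuous (fun u : ℝ => Real.log (1 + a * s * u ^ 2)) := by
    intro s hs
    refine Continuous.log (by fun_prop) (fun u => ?_)
    have : 0 ≤ a * s * u ^ 2 := by positivity
    linarith
  have key : Tendsto (fun s : ℝ => ∫ u in (0:ℝ)..1,
      (Real.log (1 + s) - Real.log (1 + a * s * u ^ 2)) / Real.log 2 * w u) atTop
      (𝓝 (∫ u in (0:ℝ)..1, Real.log (1 / (a * u ^ 2)) / Real.log 2 * w u)) := by
    apply intervalIntegral.tendsto_integral_filter_of_dominated_convergence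
      (fun _ => (a + 2) / Real.log 2 * (2 * ((k:ℝ) + 2) * ((k:ℝ) + 1)))
    · filter_upwards [eventually_ge_atTop 0] with s hs
      exact (((continuous_const.sub (hcont s hs)).div_const _).mul hw).aestronglyMeasurable
    · filter_upwards [eventually_ge_atTop 0] with s hs
      refine Eventually.of_forall fun u hu => ?_
      rw [Set.uIoc_of_le zero_le_one] at hu
      obtain ⟨hu0, hu1⟩ := hu
      have hb := gap_ratio_bound a s u ha1 hs hu0 hu1
      have hu2 : u ^ 2 ≤ 1 := by nlinarith
      have hq0 : 0 ≤ 1 - u ^ 2 := by linarith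
      have hq : (1 - u ^ 2) ^ k ≤ 1 := pow_le_one₀ hq0 (by nlinarith)
      have hq' : 0 ≤ (1 - u ^ 2) ^ k := pow_nonneg hq0 k
      have hwn : 0 ≤ w u := by positivity
      rw [Real.norm_eq_abs, abs_mul, abs_div, abs_of_pos hl2, abs_of_nonneg hwn]
      have hC : 0 ≤ 2 * ((k:ℝ) + 2) * ((k:ℝ) + 1) := by positivity
      have hwle : w u ≤ 2 * ((k:ℝ) + 2) * ((k:ℝ) + 1) * u := by
        have h3 : u ^ 3 * (1 - u ^ 2) ^ k ≤ u := by
          calc u ^ 3 * (1 - u ^ 2) ^ k ≤ u ^ 3 * 1 := by gcongr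
            _ ≤ u := by nlinarith
        calc w u = 2 * ((k:ℝ) + 2) * ((k:ℝ) + 1) * (u ^ 3 * (1 - u ^ 2) ^ k) := by
              simp only [w]; ring
          _ ≤ _ := by gcongr
      calc _ ≤ (a + 2 / u) / Real.log 2 * (2 * ((k:ℝ) + 2) * ((k:ℝ) + 1) * u) := by gcongr
        _ = (a * u + 2) / Real.log 2 * (2 * ((k:ℝ) + 2) * ((k:ℝ) + 1)) := by field_simp
        _ ≤ _ := by
          gcongr
          nlinarith
    · exact intervalIntegrable_const
    · refine Eventually.of_forall fun u hu => ?_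
      rw [Set.uIoc_of_le zero_le_one] at hu
      exact ((gap_pointwise a u ha1 hu.1).div_const _).mul_const _
  have hlim : 2 * ((k:ℝ) + 2) * ((k:ℝ) + 1) *
      ∫ u in (0:ℝ)..1, Real.logb 2 (2 / (((k + 3 : ℕ) : ℝ) * u ^ 2)) * u ^ 3 * (1 - u ^ 2) ^ k
      = ∫ u in (0:ℝ)..1, Real.log (1 / (a * u ^ 2)) / Real.log 2 * w u := by
    rw [← intervalIntegral.integral_const_mul]
    congr 1
    funext u
    have : (2 / (((k + 3 : ℕ) : ℝ) * u ^ 2)) = 1 / (a * u ^ 2) := by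
      rw [ha, div_mul_eq_mul_div, one_div_div]
    rw [this, Real.logb]
    simp only [w]
    ring
  rw [hlim]
  refine key.congr' ?_
  filter_upwards [eventually_ge_atTop 0] with s hs
  rw [hΔ s hs]
  have hone := gap_weight_integral k
  have h1 : Real.logb 2 (1 + s) = ∫ u in (0:ℝ)..1, Real.logb 2 (1 + s) * w u := by
    rw [intervalIntegral.integral_const_mul]
    simp only [w]
    rw [hone, mul_one]
  have h2 : ∀ u : ℝ, Real.logb 2 (1 + (((k + 3 : ℕ) : ℝ) * s / 2) * u ^ 2) *
      (2 * ((k:ℝ) + 2) * ((k:ℝ) + 1) * u ^ 3 * (1 - u ^ 2) ^ k)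
      = Real.log (1 + a * s * u ^ 2) / Real.log 2 * w u := by
    intro u
    rw [Real.logb, ha, div_mul_eq_mul_div (((k + 3 : ℕ) : ℝ)) 2 s]
  simp only [h2]
  rw [h1, ← intervalIntegral.integral_sub]
  · congr 1
    funext u
    rw [Real.logb]
    ring
  · exact (continuous_const.mul hw).intervalIntegrable _ _
  · exact (((hcont s hs).div_const _).mul hw).intervalIntegrable _ _
end

section
/- As M → ∞ (over the integers M ≥ 3), Δ_M := 2(M−1)(M−2) ∫₀¹ log₂( 2/(M u²) ) u³ (1−u²)^{M−3} du converges to ∫₀^∞ log₂(2/z) · z e^{−z} dz. -/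
open Filter Topology

noncomputable def gAux (M : ℕ) (z : ℝ) : ℝ :=
  (z * Real.log 2 - z * Real.log z) / Real.log 2 * (1 - z / M) ^ (M - 3)

lemma gAux_cont (M : ℕ) : Continuous (gAux M) := by
  unfold gAux
  have := Real.continuous_mul_log
  fun_prop

lemma logb_aux (z : ℝ) : Real.logb 2 (2 / z) * z
    = (z * Real.log 2 - z * Real.log z) / Real.log 2 := by
  rcases eq_or_ne z 0 with rfl | hz
  · simp
  · rw [Real.logb, Real.log_div two_ne_zero hz]; ring

lemma subst_aux (M : ℕ) (hM : 3 ≤ M) :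
    2 * (M:ℝ) ^ 2 * ∫ u in (0:ℝ)..1, Real.logb 2 (2 / (M * u ^ 2)) * u ^ 3 * (1 - u ^ 2) ^ (M - 3)
      = ∫ z in (0:ℝ)..M, gAux M z := by
  have hM0 : (M:ℝ) ≠ 0 := by positivity
  have h := intervalIntegral.integral_comp_mul_deriv (a := 0) (b := 1)
    (f := fun u : ℝ => (M:ℝ) * u ^ 2) (f' := fun u => (M:ℝ) * (2 * u)) (g := gAux M)
    (fun x _ => by simpa using (hasDerivAt_pow 2 x).const_mul (M:ℝ))
    (by fun_prop) (gAux_cont M)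
  simp only [Function.comp] at h
  norm_num at h
  rw [← h, ← intervalIntegral.integral_const_mul]
  congr 1
  ext u
  rw [gAux, ← logb_aux, mul_div_cancel_left₀ _ hM0]
  ring

lemma bound_aux (z : ℝ) (hz : 0 < z) :
    |(z * Real.log 2 - z * Real.log z) / Real.log 2| ≤ (z + 1 + z ^ 2) / Real.log 2 := by
  have h2 : 0 < Real.log 2 := Real.log_pos (by norm_num)
  have h2' : Real.log 2 ≤ 1 := by have := Real.log_two_lt_d9; linarith
  rw [abs_div, abs_of_pos h2]
  gcongr
  have h3 : |z * Real.log z| ≤ 1 + z ^ 2 := by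
    rcases le_total z 1 with h | h
    · have := Real.abs_log_mul_self_lt z hz h
      rw [mul_comm]; nlinarith
    · have := Real.log_nonneg h
      have h5 := Real.log_le_sub_one_of_pos hz
      rw [abs_of_nonneg (by positivity)]
      nlinarith
  have h4 : |z * Real.log 2| ≤ z := by
    rw [abs_of_nonneg (by positivity)]; nlinarith
  have := abs_sub (z * Real.log 2) (z * Real.log z)
  linarith

lemma int_aux (n : ℕ) : MeasureTheory.IntegrableOn
    (fun z : ℝ => z ^ n * Real.exp (-(z / 2))) (Set.Ioi 0) := by
  have h := integrableOn_rpow_mul_exp_neg_mul_rpow (s := n) (p := 1) (b := 1/2)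
    (by have : (0:ℝ) ≤ n := by positivity
        linarith) (by norm_num) (by norm_num)
  refine h.congr_fun (fun z _ => ?_) measurableSet_Ioi
  simp only [Real.rpow_natCast, Real.rpow_one]
  congr 2; ring

lemma main_aux : Tendsto (fun M : ℕ => ∫ z in (0:ℝ)..M, gAux M z) atTop
      (𝓝 (∫ z in Set.Ioi (0:ℝ), Real.logb 2 (2 / z) * z * Real.exp (-z))) := by
  have e : ∀ M : ℕ, ∫ z in (0:ℝ)..M, gAux M z
      = ∫ z in Set.Ioi (0:ℝ), (Set.Ioc (0:ℝ) M).indicator (gAux M) z := by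
    intro M
    rw [intervalIntegral.integral_of_le (by positivity),
      MeasureTheory.setIntegral_indicator measurableSet_Ioc]
    congr 2
    ext x; simp
  simp only [e]
  refine MeasureTheory.tendsto_integral_filter_of_dominated_convergence
    (fun z => (z + 1 + z ^ 2) / Real.log 2 * Real.exp (-(z / 2))) ?_ ?_ ?_ ?_
  · exact Eventually.of_forall fun M =>
      ((gAux_cont M).measurable.indicator measurableSet_Ioc).aestronglyMeasurable
  · filter_upwards [eventually_ge_atTop 6] with M hM
    filter_upwards [MeasureTheory.ae_restrict_mem measurableSet_Ioi] with z hz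
    have hz : 0 < z := hz
    have h2 : 0 < Real.log 2 := Real.log_pos (by norm_num)
    by_cases hzM : z ∈ Set.Ioc (0:ℝ) M
    · rw [Set.indicator_of_mem hzM, gAux, norm_mul]
      have hM0 : (0:ℝ) < M := by positivity
      have h1 : 0 ≤ 1 - z / M := by
        rw [sub_nonneg, div_le_one hM0]; exact hzM.2
      refine mul_le_mul (bound_aux z hz) ?_ (norm_nonneg _) (by positivity)
      rw [Real.norm_of_nonneg (by positivity)]
      calc (1 - z / M) ^ (M - 3) ≤ (Real.exp (-(z / M))) ^ (M - 3) := by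
            gcongr
            exact Real.one_sub_le_exp_neg _
        _ = Real.exp (((M - 3 : ℕ) : ℝ) * (-(z / M))) := by rw [Real.exp_nat_mul]
        _ ≤ _ := by
            rw [Real.exp_le_exp, Nat.cast_sub (by omega)]
            have h6 : (6:ℝ) ≤ M := by exact_mod_cast hM
            have : z / 2 = (M / 2 : ℝ) * (z / M) := by field_simp
            have h7 : 0 < z / M := by positivity
            rw [this]; push_cast; nlinarith
    · rw [Set.indicator_of_notMem hzM]; simp; positivity
  · have := (((int_aux 1).add (int_aux 0)).add (int_aux 2)).const_mul (1 / Real.log 2)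
    refine this.congr (Eventually.of_forall fun z => ?_)
    simp only [Pi.add_apply]
    ring
  · filter_upwards [MeasureTheory.ae_restrict_mem measurableSet_Ioi] with z hz
    have hz : 0 < z := hz
    have t1 := Real.tendsto_one_add_div_pow_exp (-z)
    have t0 : Tendsto (fun M : ℕ => 1 - z / (M:ℝ)) atTop (𝓝 1) := by
      simpa using (tendsto_const_div_atTop_nhds_zero_nat z).const_sub 1
    have t2 := (t1.div (t0.pow 3) (by norm_num)).const_mul (Real.logb 2 (2 / z) * z)
    rw [one_pow, div_one] at t2
    refine t2.congr' ?_
    obtain ⟨N, hN⟩ := exists_nat_gt z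
    filter_upwards [eventually_ge_atTop N, eventually_ge_atTop 3] with M h1 h3
    have h1' : z < M := hN.trans_le (by exact_mod_cast h1)
    have hM0 : (0:ℝ) < M := hz.trans h1'
    have hp : 0 < 1 - z / M := by rw [sub_pos, div_lt_one hM0]; exact h1'
    rw [Set.indicator_of_mem (show z ∈ Set.Ioc (0:ℝ) M from ⟨hz, h1'.le⟩), gAux, ← logb_aux]
    congr 1
    simp only [Pi.div_apply]
    rw [pow_sub₀ _ hp.ne' h3, neg_div, ← sub_eq_add_neg]
    rfl

/-- As `M → ∞` (over the integers `M ≥ 3`),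
`Δ_M := 2(M−1)(M−2) ∫₀¹ log₂( 2/(M u²) ) u³ (1−u²)^{M−3} du` converges to
`∫₀^∞ log₂(2/z) · z e^{−z} dz`. -/
theorem deltaM_tendsto (Δ : ℕ → ℝ)
    (hΔ : ∀ M : ℕ, 3 ≤ M → Δ M = 2 * ((M:ℝ) - 1) * ((M:ℝ) - 2) *
      ∫ u in (0:ℝ)..1, Real.logb 2 (2 / (M * u ^ 2)) * u ^ 3 * (1 - u ^ 2) ^ (M - 3)) :
    Tendsto Δ atTop
      (𝓝 (∫ z in Set.Ioi (0:ℝ), Real.logb 2 (2 / z) * z * Real.exp (-z))) := by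
  have t (c : ℝ) : Tendsto (fun M : ℕ => 1 - c / (M:ℝ)) atTop (𝓝 1) := by
    simpa using (tendsto_const_div_atTop_nhds_zero_nat c).const_sub 1
  have h := ((t 1).mul (t 2)).mul main_aux
  rw [one_mul, one_mul] at h
  refine h.congr' ?_
  filter_upwards [eventually_ge_atTop 3] with M hM
  have hM0 : (M:ℝ) ≠ 0 := by positivity
  rw [hΔ M hM, ← subst_aux M hM]
  field_simp
end

section
/- For every integer M ≥ 3 and every real s ≥ 0, the IR-BF-A gap satisfies the universal bound Δ(s, M) = log₂(1+s) − ∫₀¹ log₂(1 + (M s/2) u²) · 2(M−1)(M−2) u³ (1−u²)^{M−3} du ≤ 1 − (log₂ e)(1 − γ) ≈ 0.39 bits per symbol, where γ is the Euler–Mascheroni constant. -/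
open Finset in
theorem aux_F (n : ℕ) (t : ℝ) : HasDerivAt (fun t : ℝ => 1 - (1-t)^(n+2) - (n+2) * t * (1-t)^(n+1))
    (((n:ℝ)+2)*(n+1)*t*(1-t)^n) t := by
  have h1 : HasDerivAt (fun t : ℝ => 1 - t) (-1) t := by
    simpa using (hasDerivAt_id t).const_sub 1
  have h2 := h1.pow (n+2)
  have h3 := h1.pow (n+1)
  have h4 := ((hasDerivAt_id t).const_mul ((n:ℝ)+2)).mul h3
  have h5 := (h2.const_sub 1).sub h4
  refine HasDerivAt.congr_deriv h5 ?_
  simp only [Nat.add_sub_cancel, id, Pi.pow_apply, show n + 2 - 1 = n + 1 from rfl]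
  push_cast
  ring

theorem aux_K (n : ℕ) (t : ℝ) : HasDerivAt (fun t : ℝ => -(((n:ℝ)+2)*(n+1)/2) * (t^2 * (1-t)^(n+1)))
    ((((n:ℝ)+3)/2 * t - 1) * (((n:ℝ)+2)*(n+1)*t*(1-t)^n)) t := by
  have h1 : HasDerivAt (fun t : ℝ => 1 - t) (-1) t := by
    simpa using (hasDerivAt_id t).const_sub 1
  have h3 := h1.pow (n+1)
  have h4 := (((hasDerivAt_id t).pow 2).mul h3).const_mul (-(((n:ℝ)+2)*(n+1)/2))
  refine HasDerivAt.congr_deriv h4 ?_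
  simp only [Nat.add_sub_cancel, id, Pi.pow_apply]
  push_cast
  ring

theorem aux_geom (n : ℕ) (t : ℝ) :
    1 - (1-t)^(n+2) - (n+2) * t * (1-t)^(n+1)
      = t * ((∑ k ∈ Finset.range (n+2), (1-t)^k) - (n+2) * (1-t)^(n+1)) := by
  have := geom_sum_mul (1-t) (n+2)
  linarith

theorem aux_S (n : ℕ) (t : ℝ) :
    HasDerivAt (fun t : ℝ => ∑ k ∈ Finset.range n, (1-t)^(k+1) / ((k:ℝ)+1))
      (-∑ k ∈ Finset.range n, (1-t)^k) t := by
  rw [← Finset.sum_neg_distrib]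
  apply HasDerivAt.fun_sum
  intro k _
  have h1 : HasDerivAt (fun t : ℝ => 1 - t) (-1) t := by
    simpa using (hasDerivAt_id t).const_sub 1
  have h3 := (h1.pow (k+1)).div_const ((k:ℝ)+1)
  refine HasDerivAt.congr_deriv h3 ?_
  have : (k:ℝ)+1 ≠ 0 := by positivity
  simp only [Nat.add_sub_cancel]
  push_cast
  field_simp

theorem aux_G (n : ℕ) (t : ℝ) (ht : 0 < t) :
    HasDerivAt (fun t : ℝ => (1 - (1-t)^(n+2) - (n+2) * t * (1-t)^(n+1)) * Real.log t
      + (∑ k ∈ Finset.range (n+2), (1-t)^(k+1) / ((k:ℝ)+1)) - (1-t)^(n+2))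
    (Real.log t * (((n:ℝ)+2)*(n+1)*t*(1-t)^n)) t := by
  have h1 : HasDerivAt (fun t : ℝ => 1 - t) (-1) t := by
    simpa using (hasDerivAt_id t).const_sub 1
  have h := (((aux_F n t).mul (Real.hasDerivAt_log ht.ne')).add (aux_S (n+2) t)).sub (h1.pow (n+2))
  refine HasDerivAt.congr_deriv h ?_
  rw [aux_geom]
  simp only [show n + 2 - 1 = n + 1 from rfl]
  push_cast
  field_simp
  ring

theorem aux_cont (n : ℕ) :
    Continuous (fun t : ℝ => (1 - (1-t)^(n+2) - (n+2) * t * (1-t)^(n+1)) * Real.log t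
      + (∑ k ∈ Finset.range (n+2), (1-t)^(k+1) / ((k:ℝ)+1)) - (1-t)^(n+2)) := by
  have : (fun t : ℝ => (1 - (1-t)^(n+2) - (n+2) * t * (1-t)^(n+1)) * Real.log t
      + (∑ k ∈ Finset.range (n+2), (1-t)^(k+1) / ((k:ℝ)+1)) - (1-t)^(n+2))
      = fun t : ℝ => ((∑ k ∈ Finset.range (n+2), (1-t)^k) - (n+2) * (1-t)^(n+1)) * (t * Real.log t)
      + (∑ k ∈ Finset.range (n+2), (1-t)^(k+1) / ((k:ℝ)+1)) - (1-t)^(n+2) := by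
    funext t
    rw [aux_geom]; ring
  rw [this]
  have := Real.continuous_mul_log
  fun_prop

theorem aux_int (n : ℕ) (c d : ℝ) :
    IntervalIntegrable (fun t : ℝ => (c + Real.log t - (((n:ℝ)+3)/2 * t - 1) * d)
      * (((n:ℝ)+2)*(n+1)*t*(1-t)^n)) MeasureTheory.volume 0 1 ∧
    ∫ t in (0:ℝ)..1, (c + Real.log t - (((n:ℝ)+3)/2 * t - 1) * d)
      * (((n:ℝ)+2)*(n+1)*t*(1-t)^n) = c + 1 - (harmonic (n+2) : ℝ) := by
  have hi : IntervalIntegrable (fun t : ℝ => (c + Real.log t - (((n:ℝ)+3)/2 * t - 1) * d)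
      * (((n:ℝ)+2)*(n+1)*t*(1-t)^n)) MeasureTheory.volume 0 1 := by
    have : (fun t : ℝ => (c + Real.log t - (((n:ℝ)+3)/2 * t - 1) * d)
      * (((n:ℝ)+2)*(n+1)*t*(1-t)^n)) = fun t : ℝ => (c - (((n:ℝ)+3)/2 * t - 1) * d)
      * (((n:ℝ)+2)*(n+1)*t*(1-t)^n) + (t * Real.log t) * (((n:ℝ)+2)*(n+1)*(1-t)^n) := by
      funext t; ring
    rw [this]
    have := Real.continuous_mul_log
    apply Continuous.intervalIntegrable
    fun_prop
  refine ⟨hi, ?_⟩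
  have key := intervalIntegral.integral_eq_sub_of_hasDerivAt_of_le (a := (0:ℝ)) (b := 1) zero_le_one
    (f := fun t => c * (1 - (1-t)^(n+2) - (n+2) * t * (1-t)^(n+1)) +
      ((1 - (1-t)^(n+2) - (n+2) * t * (1-t)^(n+1)) * Real.log t
      + (∑ k ∈ Finset.range (n+2), (1-t)^(k+1) / ((k:ℝ)+1)) - (1-t)^(n+2))
      - (-(((n:ℝ)+2)*(n+1)/2) * (t^2 * (1-t)^(n+1))) * d) ?_ ?_ hi
  · rw [key]
    simp only [harmonic]
    push_cast
    simp
    ring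
  · apply Continuous.continuousOn
    exact ((by fun_prop : Continuous fun t : ℝ => c * (1 - (1-t)^(n+2) - (n+2) * t * (1-t)^(n+1))).add
      (aux_cont n)).sub (by fun_prop)
  · intro t ht
    have h := (((aux_F n t).const_mul c).add (aux_G n t ht.1)).sub ((aux_K n t).mul_const d)
    refine HasDerivAt.congr_deriv h ?_
    ring

theorem aux_pt (s X : ℝ) (hs : 0 ≤ s) (hX : 0 < X) :
    Real.log (1+s) + Real.log X - (X-1) * (1/(1+s)) ≤ Real.log (1+s*X) := by
  have h1 : 0 < 1 + s := by linarith
  have h2 : 0 < 1 + s * X := by positivity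
  have h := Real.log_le_sub_one_of_pos (x := (1+s)*X/(1+s*X)) (by positivity)
  rw [Real.log_div (by positivity) h2.ne', Real.log_mul h1.ne' hX.ne'] at h
  have h3 : (1+s)*X/(1+s*X) - 1 ≤ (X-1)*(1/(1+s)) := by
    rw [← sub_nonneg]
    have : (X-1)*(1/(1+s)) - ((1+s)*X/(1+s*X) - 1) = s * (X-1)^2/((1+s)*(1+s*X)) := by
      field_simp; ring
    rw [this]; positivity
  linarith

theorem aux_main (n : ℕ) (s : ℝ) (hs : 0 ≤ s) :
    Real.log (1 + s) - (∫ t in (0:ℝ)..1, Real.log (1 + (((n:ℝ)+3) * s / 2) * t)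
      * (((n:ℝ)+2)*(n+1)*t*(1-t)^n)) ≤ Real.log 2 - (1 - Real.eulerMascheroniConstant) := by
  obtain ⟨hi, hv⟩ := aux_int n (Real.log (1+s) + Real.log (((n:ℝ)+3)/2)) (1/(1+s))
  have hle := intervalIntegral.integral_mono_on (a := (0:ℝ)) (b := 1) zero_le_one hi
    (g := fun t => Real.log (1 + (((n:ℝ)+3) * s / 2) * t) * (((n:ℝ)+2)*(n+1)*t*(1-t)^n)) ?_ ?_
  · rw [hv] at hle
    have hg := Real.eulerMascheroniSeq_lt_eulerMascheroniConstant (n+2)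
    rw [Real.eulerMascheroniSeq] at hg
    rw [Real.log_div (by positivity) (by norm_num)] at hle
    push_cast at hg hle
    rw [show (n:ℝ)+2+1 = n+3 by ring] at hg
    linarith
  · apply ContinuousOn.intervalIntegrable
    rw [Set.uIcc_of_le zero_le_one]
    apply ContinuousOn.mul
    · apply ContinuousOn.log (by fun_prop)
      intro t ht
      have := ht.1
      positivity
    · fun_prop
  · intro t ht
    rcases ht.1.eq_or_lt with h | h
    · subst h; simp
    · apply mul_le_mul_of_nonneg_right
      · have := aux_pt s (((n:ℝ)+3)/2*t) hs (by positivity)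
        rw [Real.log_mul (by positivity) h.ne'] at this
        rw [show ((n:ℝ)+3) * s / 2 * t = s * (((n:ℝ)+3)/2*t) by ring]
        linarith
      · have : 0 ≤ 1 - t := by linarith [ht.2]
        positivity

theorem aux_subst (n : ℕ) (s : ℝ) (hs : 0 ≤ s) :
    ∫ u in (0:ℝ)..1, Real.log (1 + (((n:ℝ)+3) * s / 2) * u^2)
      * (2 * ((n:ℝ)+2)*(n+1)*u^3*(1-u^2)^n) =
    ∫ t in (0:ℝ)..1, Real.log (1 + (((n:ℝ)+3) * s / 2) * t)
      * (((n:ℝ)+2)*(n+1)*t*(1-t)^n) := by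
  have h := intervalIntegral.integral_comp_mul_deriv'' (a := (0:ℝ)) (b := 1)
    (f := fun u => u^2) (f' := fun u => 2*u)
    (g := fun t => Real.log (1 + (((n:ℝ)+3) * s / 2) * t) * (((n:ℝ)+2)*(n+1)*t*(1-t)^n))
    (by fun_prop) (fun x _ => by simpa using (hasDerivAt_pow 2 x).hasDerivWithinAt) (by fun_prop) ?_
  · simp only [Function.comp] at h
    norm_num at h
    rw [← h]
    congr 1
    funext u
    ring
  · apply ContinuousOn.mul
    · apply ContinuousOn.log (by fun_prop)
      rintro _ ⟨t, ht, rfl⟩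
      positivity
    · fun_prop


/-- For every integer `M ≥ 3` and every real `s ≥ 0`, the IR-BF-A gap
`Δ(s, M) = log₂(1+s) − ∫₀¹ log₂(1 + (M s/2) u²) · 2(M−1)(M−2) u³ (1−u²)^{M−3} du`
satisfies the universal bound `Δ(s, M) ≤ 1 − (log₂ e)(1 − γ) (≈ 0.39)`, where `γ` is the
Euler–Mascheroni constant. -/
theorem gap_universal_bound (M : ℕ) (hM : 3 ≤ M) (s : ℝ) (hs : 0 ≤ s) :
    Real.logb 2 (1 + s) -
      (∫ u in (0:ℝ)..1, Real.logb 2 (1 + (M * s / 2) * u ^ 2) *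
        (2 * ((M:ℝ) - 1) * ((M:ℝ) - 2) * u ^ 3 * (1 - u ^ 2) ^ (M - 3)))
    ≤ 1 - Real.logb 2 (Real.exp 1) * (1 - Real.eulerMascheroniConstant) := by
  obtain ⟨n, rfl⟩ := Nat.exists_eq_add_of_le' hM
  have h := aux_main n s hs
  rw [← aux_subst n s hs] at h
  have h2 : 0 < Real.log 2 := Real.log_pos (by norm_num)
  have e : (∫ u in (0:ℝ)..1, Real.logb 2 (1 + (((n+3:ℕ):ℝ) * s / 2) * u ^ 2) *
        (2 * (((n+3:ℕ):ℝ) - 1) * (((n+3:ℕ):ℝ) - 2) * u ^ 3 * (1 - u ^ 2) ^ (n + 3 - 3)))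
      = (∫ u in (0:ℝ)..1, Real.log (1 + (((n:ℝ)+3) * s / 2) * u^2)
      * (2 * ((n:ℝ)+2)*(n+1)*u^3*(1-u^2)^n)) / Real.log 2 := by
    rw [← intervalIntegral.integral_div]
    congr 1
    funext u
    rw [Real.logb, Nat.add_sub_cancel]
    push_cast
    ring
  rw [e, Real.logb, Real.logb, Real.log_exp, ← sub_div, div_le_iff₀ h2]
  refine h.trans (le_of_eq ?_)
  field_simp
end
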